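/- Suppose (G, A) is shortlex-automatic, in the following sense: the set L of all words in shortlex normal form is a regular language over A, and for each x ∈ A the set of pairs {(u,v) : u ∈ L, v ∈ L, π(u·x) = π(v)} is regular (as a padded language over A⁺ × A⁺). Then the set of U-minimal rules is regular (as a padded language over A⁺ × A⁺). -/

import Mathlib

/-- The shortlex order on words: `u < v` iff `u` is shorter, or of equal length
and lexicographically smaller. -/
def ShortLexLt {A : Type} [LinearOrder A] (u v : List A) : Prop :=
  u.length < v.length ∨ (u.length = v.length ∧ List.Lex (· < ·) u v)

/-- An elementary `R`-reduction: replace an occurrence of a left-hand side of a rule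
of `R` as a subword by the corresponding right-hand side. -/
def ElemRed {A : Type} (R : Set (List A × List A)) (u v : List A) : Prop :=
  ∃ a b lam rho : List A, (lam, rho) ∈ R ∧ u = a ++ lam ++ b ∧ v = a ++ rho ++ b

/-- A word is `R`-irreducible if no elementary `R`-reduction applies to it. -/
def Irred {A : Type} (R : Set (List A × List A)) (u : List A) : Prop :=
  ¬ ∃ v : List A, ElemRed R u v

/-- The standard assumptions on a set of rules `R`: every rule `(u,v)` satisfies
`u > v` in shortlex and `π u = π v`, and Thue equivalence (the equivalence relation
generated by elementary `R`-reductions) coincides with equality of `π`-images. -/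
def StandardAssumptions {A G : Type} [LinearOrder A] (π : List A → G)
    (R : Set (List A × List A)) : Prop :=
  (∀ p ∈ R, ShortLexLt p.2 p.1 ∧ π p.1 = π p.2) ∧
  (∀ u v : List A, Relation.EqvGen (ElemRed R) u v ↔ π u = π v)

/-- `R` is confluent if all `R`-irreducible words obtainable from a given word by
sequences of elementary `R`-reductions are equal. -/
def Confluent {A : Type} (R : Set (List A × List A)) : Prop :=
  ∀ w u v : List A, Relation.ReflTransGen (ElemRed R) w u →
    Relation.ReflTransGen (ElemRed R) w v → Irred R u → Irred R v → u = v

/-- `u` is the shortlex normal form of its `π`-image: it is shortlex-least in its `π`-fiber. -/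
def IsShortLexNF {A G : Type} [LinearOrder A] (π : List A → G) (u : List A) : Prop :=
  ∀ v : List A, π v = π u → u = v ∨ ShortLexLt u v

/-- The universal set of rules: all pairs `(u,v)` with `u > v` in shortlex and `π u = π v`. -/
def URules {A G : Type} [LinearOrder A] (π : List A → G) : Set (List A × List A) :=
  {p | ShortLexLt p.2 p.1 ∧ π p.1 = π p.2}

/-- `s` is a proper (contiguous) subword of `u`. -/
def ProperFactor {A : Type} (s u : List A) : Prop :=
  ∃ a b : List A, u = a ++ s ++ b ∧ a ++ b ≠ []

/-- A rule `(u,v)` is `R`-minimal if `v` is `R`-irreducible and every proper subword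
of `u` is `R`-irreducible. -/
def RMinimal {A : Type} (R : Set (List A × List A)) (p : List A × List A) : Prop :=
  Irred R p.2 ∧ ∀ s : List A, ProperFactor s p.1 → Irred R s

/-- The set of `U`-minimal rules. -/
def UMinRules {A G : Type} [LinearOrder A] (π : List A → G) : Set (List A × List A) :=
  {p | p ∈ URules π ∧ RMinimal (URules π) p}

/-- The padded word over `A⁺ × A⁺` (with `A⁺ = Option A`, `none` the padding symbol `$`)
associated to a pair of words `(u, v)`: the shorter word is padded at its right end so both
have the same length, and the two words are read in parallel. -/
def padPair {A : Type} (p : List A × List A) : List (Option A × Option A) :=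
  List.zip (p.1.map some ++ List.replicate (p.2.length - p.1.length) none)
           (p.2.map some ++ List.replicate (p.1.length - p.2.length) none)

/-- A set of pairs of words over `A` is regular if the corresponding set of padded words is a
regular language over `A⁺ × A⁺`. -/
def PairsRegular {A : Type} (R : Set (List A × List A)) : Prop :=
  Language.IsRegular {w : List (Option A × Option A) | ∃ p ∈ R, w = padPair p}

namespace Language

variable {α : Type}

theorem IsRegular.of_mem_iff {L L' : Language α} (h : L.IsRegular)
    (e : ∀ w, w ∈ L' ↔ w ∈ L) : L'.IsRegular := by
  rwa [show L' = L from ext e]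

theorem isRegular_zero : (0 : Language α).IsRegular :=
  ⟨Unit, inferInstance, ⟨fun s _ => s, (), ∅⟩, by ext w; simp [DFA.mem_accepts, notMem_zero]⟩

theorem isRegular_exists_mem {ι : Type} (s : Finset ι) {L : ι → Language α}
    (h : ∀ i, (L i).IsRegular) :
    Language.IsRegular {w : List α | ∃ i ∈ s, w ∈ L i} := by
  classical
  induction s using Finset.induction_on with
  | empty =>
    refine isRegular_zero.of_mem_iff fun w => iff_of_false ?_ (notMem_zero w)
    rintro ⟨i, hi, _⟩
    simp at hi
  | insert a s _ ih =>
    refine ((h a).add ih).of_mem_iff fun w => Iff.trans ?_ (mem_add _ _ w).symm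
    change (∃ i ∈ insert a s, w ∈ L i) ↔ w ∈ L a ∨ ∃ i ∈ s, w ∈ L i
    simp only [Finset.mem_insert, exists_eq_or_imp]

/-- Words whose tail, after removing one arbitrary letter, lies in a regular language. -/
theorem IsRegular.cons {L : Language α} (h : L.IsRegular) :
    Language.IsRegular {w : List α | ∃ a, ∃ t ∈ L, w = a :: t} := by
  obtain ⟨σ, _, M, rfl⟩ := h
  let N : DFA α (Option σ) :=
    { step := fun s a => some (s.elim M.start (M.step · a))
      start := none
      accept := some '' M.accept }
  have key : ∀ (w : List α) (q : σ), N.evalFrom (some q) w = some (M.evalFrom q w) := by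
    intro w
    induction w with
    | nil => intro q; rfl
    | cons a w ih => intro q; exact ih _
  refine ⟨Option σ, inferInstance, N, ?_⟩
  ext w
  rw [DFA.mem_accepts]
  cases w with
  | nil =>
    refine iff_of_false ?_ ?_
    · rintro ⟨q, _, hq⟩
      exact absurd hq (by simp [DFA.eval_nil, N])
    · rintro ⟨a, t, _, hw⟩
      exact absurd hw (by simp)
  | cons a t =>
    have : N.eval (a :: t) = some (M.eval t) := key t M.start
    rw [this]
    constructor
    · rintro ⟨q, hq, hqe⟩
      exact ⟨a, t, by rw [DFA.mem_accepts]; cases hqe; exact hq, rfl⟩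
    · rintro ⟨a', t', ht, hw⟩
      cases hw
      exact ⟨_, ht, rfl⟩

/-- Words over `Option α × β` whose first track is padding-free and lies in a regular language. -/
theorem IsRegular.fst_track {β : Type} {L : Language α} (h : L.IsRegular) :
    Language.IsRegular {w : List (Option α × β) | ∃ u ∈ L, w.map Prod.fst = u.map some} := by
  obtain ⟨σ, _, M, rfl⟩ := h
  let N : DFA (Option α × β) (Option σ) :=
    { step := fun s c => s.bind fun q => c.1.map (M.step q)
      start := some M.start
      accept := some '' M.accept }
  have dead : ∀ w : List (Option α × β), N.evalFrom none w = none := by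
    intro w
    induction w with
    | nil => rfl
    | cons c w ih => exact ih
  have key : ∀ (w : List (Option α × β)) (q : σ), N.evalFrom (some q) w ∈ N.accept ↔
      ∃ u ∈ M.acceptsFrom q, w.map Prod.fst = u.map some := by
    intro w
    induction w with
    | nil =>
      intro q
      simp [N, DFA.mem_acceptsFrom]
    | cons c w ih =>
      intro q
      obtain ⟨_ | a, b⟩ := c
      · have : N.evalFrom (some q) ((none, b) :: w) = none := dead w
        rw [this]
        refine iff_of_false (by simp [N]) ?_
        rintro ⟨_ | ⟨a, u⟩, _, hu⟩ <;> simp at hu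
      · have : N.evalFrom (some q) ((some a, b) :: w) = N.evalFrom (some (M.step q a)) w := rfl
        rw [this, ih]
        constructor
        · rintro ⟨u, hu, hw⟩
          exact ⟨a :: u, hu, by simp [hw]⟩
        · rintro ⟨_ | ⟨a', u⟩, hu, hw⟩
          · simp at hw
          · simp only [List.map_cons, List.cons.injEq, Option.some.injEq] at hw
            obtain ⟨rfl, hw⟩ := hw
            exact ⟨u, hu, hw⟩
  exact ⟨Option σ, inferInstance, N, by ext w; exact key w M.start⟩

/-- Regular languages are closed under pulling back along a rewriting of the last letter `c`
to a word `f c`, restricted to last letters satisfying `S`. -/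
theorem IsRegular.replace_last {L : Language α} (h : L.IsRegular) (S : α → Prop)
    (f : α → List α) :
    Language.IsRegular {w : List α | ∃ t c, w = t ++ [c] ∧ S c ∧ t ++ f c ∈ L} := by
  obtain ⟨σ, _, M, rfl⟩ := h
  let N : DFA α (σ × Prop) :=
    { step := fun s c => (M.step s.1 c, S c ∧ M.evalFrom s.1 (f c) ∈ M.accept)
      start := (M.start, False)
      accept := {s | s.2} }
  have hfst : ∀ w : List α, (N.eval w).1 = M.eval w := by
    intro w
    induction w using List.reverseRecOn with
    | nil => rfl
    | append_singleton t c ih =>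
      rw [DFA.eval_append_singleton, DFA.eval_append_singleton, ← ih]
  refine ⟨σ × Prop, Fintype.ofFinite _, N, ?_⟩
  ext w
  rw [DFA.mem_accepts]
  induction w using List.reverseRecOn with
  | nil =>
    refine iff_of_false (fun h => h) ?_
    rintro ⟨t, c, hw, _⟩
    simp at hw
  | append_singleton t c _ =>
    have hmem : t ++ f c ∈ M.accepts ↔ M.evalFrom (M.eval t) (f c) ∈ M.accept := by
      rw [DFA.mem_accepts, DFA.eval, DFA.evalFrom_of_append]
    have : N.eval (t ++ [c]) ∈ N.accept ↔ S c ∧ t ++ f c ∈ M.accepts := by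
      rw [DFA.eval_append_singleton, hmem, ← hfst]; rfl
    rw [this]
    constructor
    · intro h
      exact ⟨t, c, rfl, h⟩
    · rintro ⟨t', c', hw, h⟩
      obtain ⟨rfl, hc⟩ := List.append_inj' hw rfl
      cases hc
      exact h

end Language

theorem List.Lex.append_right_of_length_eq {A : Type} {r : A → A → Prop} {u v : List A}
    (h : List.Lex r u v) (hl : u.length = v.length) (b : List A) :
    List.Lex r (u ++ b) (v ++ b) := by
  induction h with
  | nil => simp at hl
  | cons _ ih => exact List.Lex.cons (ih (by simpa using hl))
  | rel h => exact List.Lex.rel h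

theorem Irred.of_factor {A : Type} {R : Set (List A × List A)} {a s b : List A}
    (h : Irred R (a ++ s ++ b)) : Irred R s := by
  rintro ⟨_, a', b', l, r, hR, rfl, rfl⟩
  exact h ⟨_, a ++ a', b' ++ b, l, r, hR, by simp, rfl⟩

section ShortLex

variable {A : Type} [LinearOrder A]

theorem ShortLexLt.irrefl (u : List A) : ¬ ShortLexLt u u := by
  rintro (h | ⟨_, h⟩)
  · exact lt_irrefl _ h
  · exact lt_irrefl u h

theorem ShortLexLt.asymm {u v : List A} (h : ShortLexLt u v) : ¬ ShortLexLt v u := by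
  rintro (h' | ⟨e', h'⟩) <;> rcases h with (h | ⟨e, h⟩)
  · omega
  · omega
  · omega
  · exact lt_asymm (a := u) (b := v) h h'

theorem shortLexLt_trichotomous (u v : List A) : ShortLexLt u v ∨ u = v ∨ ShortLexLt v u := by
  rcases lt_trichotomy u.length v.length with h | h | h
  · exact Or.inl (Or.inl h)
  · rcases lt_trichotomy u v with h' | h' | h'
    · exact Or.inl (Or.inr ⟨h, h'⟩)
    · exact Or.inr (Or.inl h')
    · exact Or.inr (Or.inr (Or.inr ⟨h.symm, h'⟩))
  · exact Or.inr (Or.inr (Or.inl h))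

theorem ShortLexLt.append_both {u v : List A} (h : ShortLexLt u v) (a b : List A) :
    ShortLexLt (a ++ u ++ b) (a ++ v ++ b) := by
  rcases h with h | ⟨e, h⟩
  · left; simp; omega
  · refine Or.inr ⟨by simp [e], ?_⟩
    rw [List.append_assoc, List.append_assoc]
    exact List.Lex.append_left _ (h.append_right_of_length_eq e b) a

theorem isShortLexNF_nil {G : Type} (π : List A → G) : IsShortLexNF π [] := by
  intro v _
  cases v with
  | nil => exact Or.inl rfl
  | cons => exact Or.inr (Or.inl (by simp))

variable {G : Type} [Group G] {π : List A → G}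

theorem irred_uRules_iff (hπ_mul : ∀ u v : List A, π (u ++ v) = π u * π v) (u : List A) :
    Irred (URules π) u ↔ IsShortLexNF π u := by
  constructor
  · intro h v hv
    rcases shortLexLt_trichotomous u v with h' | h' | h'
    · exact Or.inr h'
    · exact Or.inl h'
    · exact absurd ⟨v, [], [], u, v, ⟨h', hv.symm⟩, by simp, by simp⟩ h
  · rintro h ⟨_, a, b, l, r, ⟨hlt, hπ⟩, rfl, rfl⟩
    have hlt' := hlt.append_both a b
    rcases h (a ++ r ++ b) (by simp only [hπ_mul, hπ]) with h | h
    · rw [h] at hlt'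
      exact ShortLexLt.irrefl _ hlt'
    · exact h.asymm hlt'

theorem mem_uMinRules_iff (hπ_mul : ∀ u v : List A, π (u ++ v) = π u * π v) (u v : List A) :
    (u, v) ∈ UMinRules π ↔ ∃ w x, u = w ++ [x] ∧ IsShortLexNF π w ∧ IsShortLexNF π v ∧
      π (w ++ [x]) = π v ∧ ¬ IsShortLexNF π u ∧ IsShortLexNF π u.tail := by
  constructor
  · rintro ⟨⟨hlt, hπ⟩, hv, hs⟩
    rw [irred_uRules_iff hπ_mul] at hv
    have hu : ¬ IsShortLexNF π u := fun h => by
      rcases h v hπ.symm with h | h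
      · exact ShortLexLt.irrefl v (by simpa [h] using hlt)
      · exact h.asymm hlt
    rcases List.eq_nil_or_concat' u with rfl | ⟨w, x, rfl⟩
    · exact absurd (isShortLexNF_nil π) hu
    · refine ⟨w, x, rfl, ?_, hv, hπ, hu, ?_⟩
      · exact (irred_uRules_iff hπ_mul _).1 (hs w ⟨[], [x], by simp, by simp⟩)
      · refine (irred_uRules_iff hπ_mul _).1 (hs _ ?_)
        cases w with
        | nil => exact ⟨[x], [], by simp, by simp⟩
        | cons y w => exact ⟨[y], [], by simp, by simp⟩
  · rintro ⟨w, x, rfl, hw, hv, hπ, hu, ht⟩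
    refine ⟨⟨?_, hπ⟩, (irred_uRules_iff hπ_mul _).2 hv, ?_⟩
    · rcases hv _ hπ with h | h
      · exact absurd (h ▸ hv) hu
      · exact h
    · rintro s ⟨a, b, hab, hne⟩
      rw [← irred_uRules_iff hπ_mul] at hw ht
      dsimp only at hab
      cases a with
      | cons y a =>
        rw [hab] at ht
        exact Irred.of_factor (a := a) (b := b) (by simpa using ht)
      | nil =>
        rcases List.eq_nil_or_concat' b with rfl | ⟨b, y, rfl⟩
        · simp at hne
        · have : w = s ++ b := by
            rw [List.nil_append, ← List.append_assoc] at hab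
            exact (List.append_inj' hab rfl).1
          exact Irred.of_factor (a := []) (b := b) (by simpa [this] using hw)

end ShortLex

section Padding

variable {A : Type}

theorem map_fst_padPair (u v : List A) :
    (padPair (u, v)).map Prod.fst = u.map some ++ List.replicate (v.length - u.length) none := by
  rw [padPair, List.map_fst_zip]
  simp
  omega

theorem padPair_append_left {w v : List A} (x : A) (h : v.length ≤ w.length) :
    padPair (w ++ [x], v) = padPair (w, v) ++ [(some x, none)] := by
  have h1 : v.length - (w.length + 1) = 0 := by omega
  have h2 : v.length - w.length = 0 := by omega
  have h3 : w.length + 1 - v.length = w.length - v.length + 1 := by omega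
  simp only [padPair, List.length_append, List.length_singleton, h1, h2, h3,
    List.replicate_succ', List.replicate_zero, List.append_nil, List.map_append, List.map_cons,
    List.map_nil, ← List.append_assoc]
  rw [List.zip_append (by simp; omega)]
  rfl

theorem padPair_append_both {w v : List A} (x y : A) (h : v.length = w.length) :
    padPair (w ++ [x], v ++ [y]) = List.zip (w.map some) (v.map some) ++ [(some x, some y)] := by
  simp only [padPair, List.length_append, List.length_singleton, h, Nat.sub_self,
    List.replicate_zero, List.append_nil, List.map_append, List.map_cons, List.map_nil]
  rw [List.zip_append (by simp [h])]
  rfl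

theorem padPair_append_right {w v : List A} (y : A) (h : v.length = w.length) :
    padPair (w, v ++ [y]) = List.zip (w.map some) (v.map some) ++ [(none, some y)] := by
  have h1 : w.length + 1 - w.length = 1 := by omega
  have h2 : w.length - (w.length + 1) = 0 := by omega
  simp only [padPair, List.length_append, List.length_singleton, h, h1, h2, List.replicate_one,
    List.replicate_zero, List.append_nil, List.map_append, List.map_cons, List.map_nil]
  rw [List.zip_append (by simp [h])]
  rfl

/-- What remains of the last letter of a padded pair `(wx, v)` once `x` is deleted: a padded letter
if the second track still carries a letter there, and nothing otherwise. -/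
def stripLast (c : Option A × Option A) : List (Option A × Option A) :=
  c.2.elim [] fun y => [(none, some y)]

theorem eq_padPair_append (w v : List A) (x : A) (W : List (Option A × Option A))
    (t : List (Option A × Option A)) (b : Option A) (hW : W = t ++ [(some x, b)])
    (hfst : none ∉ W.map Prod.fst) (ht : t ++ stripLast (some x, b) = padPair (w, v)) :
    W = padPair (w ++ [x], v) := by
  classical
  subst hW
  have hcount := congrArg (fun l => List.count none (List.map Prod.fst l)) ht
  have htn : List.count none (t.map Prod.fst) = 0 :=
    List.count_eq_zero.2 fun h => hfst (List.map_append ▸ List.mem_append_left _ h)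
  have hwn : List.count none (w.map some) = 0 := List.count_eq_zero.2 (by simp)
  simp only [map_fst_padPair, List.map_append, List.count_append, htn, hwn,
    List.count_replicate_self, zero_add] at hcount
  cases b with
  | none =>
    simp [stripLast] at hcount ht
    rw [padPair_append_left x (by omega), ht]
  | some y =>
    simp [stripLast] at hcount ht
    rcases List.eq_nil_or_concat' v with rfl | ⟨v, z, rfl⟩
    · simp at hcount
    · have hl : v.length = w.length := by simp at hcount; omega
      rw [padPair_append_right z hl] at ht
      obtain ⟨rfl, hz⟩ := List.append_inj' ht rfl
      simp at hz
      rw [padPair_append_both x z hl, hz]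

theorem exists_padPair_append {w v : List A} (x : A) (h : v.length ≤ w.length + 1) :
    ∃ t b, padPair (w ++ [x], v) = t ++ [(some x, b)] ∧
      t ++ stripLast (some x, b) = padPair (w, v) := by
  rcases Nat.lt_or_ge w.length v.length with h' | h'
  · rcases List.eq_nil_or_concat' v with rfl | ⟨v, z, rfl⟩
    · simp at h'
    · have hl : v.length = w.length := by simp at h h'; omega
      exact ⟨_, some z, padPair_append_both x z hl, (padPair_append_right z hl).symm⟩
  · exact ⟨_, none, padPair_append_left x h', by simp [stripLast]⟩

end Padding

/-- If `(G, A)` is shortlex-automatic -- the language `L` of shortlex normal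
forms is regular, and each multiplier relation `{(u,v) | u,v ∈ L, π(u·x) = π(v)}` is regular
as a padded language -- then the set of `U`-minimal rules is regular as a padded language. -/
theorem stmt9 {A G : Type} [Fintype A] [LinearOrder A] [Group G]
    (π : List A → G) (hπ_nil : π [] = 1)
    (hπ_mul : ∀ u v : List A, π (u ++ v) = π u * π v)
    (hπ_surj : Function.Surjective π)
    (ι : A → A) (hι : Function.Involutive ι)
    (hι_inv : ∀ x : A, π [ι x] = (π [x])⁻¹)
    (hL : Language.IsRegular {u : List A | IsShortLexNF π u})
    (hmult : ∀ x : A, PairsRegular {p : List A × List A |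
        IsShortLexNF π p.1 ∧ IsShortLexNF π p.2 ∧ π (p.1 ++ [x]) = π p.2}) :
    PairsRegular (UMinRules π) := by
  have hK : Language.IsRegular {u : List A | ¬ IsShortLexNF π u ∧ IsShortLexNF π u.tail} := by
    refine (hL.compl.inf hL.cons).of_mem_iff fun u => Iff.trans ?_ Language.mem_inf.symm
    refine and_congr_right fun hu => ?_
    cases u with
    | nil => exact absurd (isShortLexNF_nil π) hu
    | cons a t =>
      constructor
      · intro ht
        exact ⟨a, t, ht, rfl⟩
      · rintro ⟨_, _, ht, h⟩
        cases h
        exact ht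
  have hM := Language.isRegular_exists_mem Finset.univ fun x : A =>
    (hmult x).replace_last (fun c => c.1 = some x) stripLast
  refine ((hK.fst_track (β := Option A)).inf hM).of_mem_iff fun W =>
    Iff.trans ?_ Language.mem_inf.symm
  constructor
  · rintro ⟨⟨u, v⟩, hp, rfl⟩
    have hlen : v.length ≤ u.length := by
      rcases hp.1.1 with h | h
      · exact h.le
      · exact h.1.le
    obtain ⟨w, x, rfl, hw, hv, hπ, hu, ht⟩ := (mem_uMinRules_iff hπ_mul u v).1 hp
    refine ⟨⟨w ++ [x], ⟨hu, ht⟩, ?_⟩, x, Finset.mem_univ x, ?_⟩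
    · rw [map_fst_padPair, Nat.sub_eq_zero_of_le hlen]
      simp
    · obtain ⟨t, b, h1, h2⟩ := exists_padPair_append (w := w) (v := v) x (by simpa using hlen)
      exact ⟨t, _, h1, rfl, (w, v), ⟨hw, hv, hπ⟩, h2⟩
  · rintro ⟨⟨u, ⟨hu, ht⟩, hfst⟩, x, -, t, ⟨_, b⟩, hW, rfl, ⟨w, v⟩, ⟨hw, hv, hπ⟩, hp⟩
    have hW' := eq_padPair_append w v x W t b hW (by simp [hfst]) hp
    have hux : u = w ++ [x] := by
      rw [hW', map_fst_padPair] at hfst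
      have hn : List.replicate (v.length - (w ++ [x]).length) (none : Option A) = [] := by
        rw [List.eq_nil_iff_forall_not_mem]
        intro a ha
        have hmem : a ∈ u.map some := hfst ▸ List.mem_append_right _ ha
        rw [(List.mem_replicate.1 ha).2] at hmem
        simp at hmem
      rw [hn, List.append_nil] at hfst
      exact (List.map_injective_iff.2 (Option.some_injective A) hfst).symm
    subst hux
    exact ⟨(w ++ [x], v), (mem_uMinRules_iff hπ_mul _ v).2 ⟨w, x, rfl, hw, hv, hπ, hu, ht⟩, hW'⟩
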